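/- Let u ~ ST_M(ν̃, m, S) with ν̃ > 2, mean m, covariance S, S symmetric positive definite. Then E[log(1 + (u−m)ᵀS⁻¹(u−m)/(ν̃−2))] = Ψ((ν̃+M)/2) − Ψ(ν̃/2), where Ψ is the digamma function. -/

import Mathlib

open Real MeasureTheory Matrix Filter Topology

/-- The multivariate Student-t density (covariance parameterization, `ν > 2`). -/
noncomputable def stPdf {ι : Type*} [Fintype ι] [DecidableEq ι] (ν : ℝ) (φ : ι → ℝ)
    (K : Matrix ι ι ℝ) (y : ι → ℝ) : ℝ :=
  (Real.Gamma ((ν + Fintype.card ι) / 2) * K.det ^ (-(1 : ℝ) / 2)) /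
      (Real.Gamma (ν / 2) * ((ν - 2) * Real.pi) ^ ((Fintype.card ι : ℝ) / 2)) *
    (1 + (y - φ) ⬝ᵥ (K⁻¹ *ᵥ (y - φ)) / (ν - 2)) ^ (-(ν + Fintype.card ι) / 2)

/-- The multivariate Gaussian density `N(y | μ, Σ)`. -/
noncomputable def gaussPdf {ι : Type*} [Fintype ι] [DecidableEq ι] (μ : ι → ℝ)
    (Cov : Matrix ι ι ℝ) (y : ι → ℝ) : ℝ :=
  (2 * Real.pi) ^ (-(Fintype.card ι : ℝ) / 2) * Cov.det ^ (-(1 : ℝ) / 2) *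
    Real.exp (-((y - μ) ⬝ᵥ (Cov⁻¹ *ᵥ (y - μ))) / 2)

/-- Density of `r` when `r⁻¹ ~ Gamma(a, b)` (shape `a`, rate `b`). -/
noncomputable def invGammaPdf (a b r : ℝ) : ℝ :=
  b ^ a / Real.Gamma a * r ^ (-a - 1) * Real.exp (-b / r)

/-- The digamma function `Ψ = (log ∘ Γ)'`. -/
noncomputable def digamma (x : ℝ) : ℝ := deriv (fun t => Real.log (Real.Gamma t)) x

theorem bj_int {M : ℕ} {s : ℝ} (hs : (M:ℝ)/2 < s) :
    Integrable (fun x : EuclideanSpace ℝ (Fin M) => (1 + ‖x‖^2) ^ (-s)) := by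
  have := integrable_rpow_neg_one_add_norm_sq (E := EuclideanSpace ℝ (Fin M)) (μ := volume) (r := 2*s) (by simp; linarith)
  convert! this using 3
  ring

theorem gauss_int {M : ℕ} {t : ℝ} (ht : 0 < t) :
    Integrable (fun x : EuclideanSpace ℝ (Fin M) => rexp (-t * ‖x‖^2)) := by
  have h : ∫ x : EuclideanSpace ℝ (Fin M), rexp (-t * ‖x‖^2) ≠ 0 := by
    rw [GaussianFourier.integral_rexp_neg_mul_sq_norm ht]
    positivity
  exact not_imp_comm.1 integral_undef h

theorem bj_eval {M : ℕ} {s : ℝ} (hs : (M:ℝ)/2 < s) :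
    ∫ x : EuclideanSpace ℝ (Fin M), (1 + ‖x‖^2) ^ (-s) =
      π ^ ((M:ℝ)/2) * Gamma (s - M/2) / Gamma s := by
  have hs0 : 0 < s := lt_of_le_of_lt (by positivity) hs
  have key : ∀ t ∈ Set.Ioi (0:ℝ), ∫ x : EuclideanSpace ℝ (Fin M), t^(s-1) * rexp (-t) * rexp (-t * ‖x‖^2)
      = π ^ ((M:ℝ)/2) * (rexp (-t) * t^(s - M/2 - 1)) := by
    intro t ht
    have ht : 0 < t := ht
    rw [integral_const_mul, GaussianFourier.integral_rexp_neg_mul_sq_norm ht,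
      finrank_euclideanSpace_fin, div_rpow pi_pos.le ht.le, show s - M/2 - 1 = (s-1) - M/2 by ring,
      rpow_sub ht (s-1)]
    ring
  have hint : Integrable (Function.uncurry fun (t:ℝ) (x : EuclideanSpace ℝ (Fin M)) =>
      t^(s-1) * rexp (-t) * rexp (-t * ‖x‖^2)) ((volume.restrict (Set.Ioi 0)).prod volume) := by
    rw [integrable_prod_iff]
    · constructor
      · filter_upwards [ae_restrict_mem measurableSet_Ioi] with t ht
        exact (gauss_int ht).const_mul (t^(s-1) * rexp (-t))
      · refine ((GammaIntegral_convergent (s := s - M/2) (by linarith)).const_mul (π ^ ((M:ℝ)/2))).congr ?_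
        filter_upwards [ae_restrict_mem measurableSet_Ioi] with t ht
        have ht' : 0 < t := ht
        rw [← key t ht]
        congr 1 with x
        simp only [Function.uncurry]
        rw [Real.norm_of_nonneg (by positivity)]
    · apply Measurable.aestronglyMeasurable
      simp only [Function.uncurry_def]
      fun_prop
  have h1 := integral_integral_swap hint
  rw [setIntegral_congr_fun measurableSet_Ioi key, integral_const_mul,
    ← Gamma_eq_integral (by linarith)] at h1
  rw [h1, eq_div_iff (Gamma_pos_of_pos hs0).ne', ← integral_mul_const]
  congr 1 with x
  have hx : 0 < 1 + ‖x‖^2 := by positivity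
  have := integral_rpow_mul_exp_neg_mul_Ioi hs0 hx
  rw [rpow_neg hx.le, ← inv_rpow hx.le, ← one_div, ← this]
  congr 1 with t
  rw [mul_assoc, ← Real.exp_add]
  ring_nf

theorem bj_deriv {M : ℕ} {s : ℝ} (hs : (M:ℝ)/2 < s) :
    HasDerivAt (fun s => ∫ x : EuclideanSpace ℝ (Fin M), (1 + ‖x‖^2) ^ (-s))
      (∫ x : EuclideanSpace ℝ (Fin M), -(log (1 + ‖x‖^2) * (1 + ‖x‖^2) ^ (-s))) s := by
  set ε := (s - M/2)/3 with hε
  have hε0 : 0 < ε := by rw [hε]; linarith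
  refine (hasDerivAt_integral_of_dominated_loc_of_deriv_le (s := Set.Ioi (s - ε))
    (F' := fun s (x : EuclideanSpace ℝ (Fin M)) => -(log (1 + ‖x‖^2) * (1 + ‖x‖^2) ^ (-s)))
    (bound := fun x => (1 + ‖x‖^2) ^ (-(s - 2*ε)) / ε)
    (Ioi_mem_nhds (by linarith)) ?_ (bj_int hs) ?_ ?_ ((bj_int (by linarith)).div_const _) ?_).2
  · exact .of_forall fun t => Measurable.aestronglyMeasurable (by fun_prop)
  · exact Measurable.aestronglyMeasurable (by fun_prop)
  · refine .of_forall fun x t ht => ?_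
    have ht : s - ε < t := ht
    have h1 : 1 ≤ 1 + ‖x‖^2 := by linarith [sq_nonneg ‖x‖]
    generalize 1 + ‖x‖^2 = y at h1
    have hl := log_nonneg h1
    have hy : 0 < y := by linarith
    rw [norm_neg, Real.norm_of_nonneg (by positivity)]
    calc log y * y ^ (-t) ≤ (y ^ ε / ε) * y ^ (-(s-ε)) := by
          gcongr
          · exact log_le_rpow_div hy.le hε0
      _ = y ^ (-(s - 2*ε)) / ε := by
          rw [div_mul_eq_mul_div, ← rpow_add hy]; ring_nf
  · refine .of_forall fun x t _ => ?_
    have hx : 0 < 1 + ‖x‖^2 := by positivity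
    convert! (hasDerivAt_neg t).const_rpow hx using 1
    ring

theorem bj_log {M : ℕ} {s : ℝ} (hs : (M:ℝ)/2 < s) :
    ∫ x : EuclideanSpace ℝ (Fin M), log (1 + ‖x‖^2) * (1 + ‖x‖^2) ^ (-s) =
      π ^ ((M:ℝ)/2) * Gamma (s - M/2) / Gamma s *
        (deriv (fun t => log (Gamma t)) s - deriv (fun t => log (Gamma t)) (s - M/2)) := by
  have hs0 : 0 < s := lt_of_le_of_lt (by positivity) hs
  have hd : ∀ t : ℝ, 0 < t → HasDerivAt (fun t => log (Gamma t)) (deriv (fun t => log (Gamma t)) t) t := by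
    intro t ht
    refine DifferentiableAt.hasDerivAt (DifferentiableAt.log (differentiableAt_Gamma ?_) (Gamma_pos_of_pos ht).ne')
    intro m h
    have : (0:ℝ) ≤ m := m.cast_nonneg
    linarith
  have h1 := bj_deriv hs
  have hsub : HasDerivAt (fun t : ℝ => t - (M:ℝ)/2) 1 s := (hasDerivAt_id s).sub_const _
  have h2 := (((hd (s - M/2) (by linarith)).comp s hsub).sub (hd s hs0)).exp.const_mul (π ^ ((M:ℝ)/2))
  have h3 : (fun s => ∫ x : EuclideanSpace ℝ (Fin M), (1 + ‖x‖^2) ^ (-s)) =ᶠ[𝓝 s]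
      fun t => π ^ ((M:ℝ)/2) * rexp (log (Gamma (t - M/2)) - log (Gamma t)) := by
    filter_upwards [Ioi_mem_nhds hs] with t ht
    have ht : (M:ℝ)/2 < t := ht
    have ht0 : 0 < t := lt_of_le_of_lt (by positivity) ht
    rw [bj_eval ht, Real.exp_sub, Real.exp_log (Gamma_pos_of_pos (by linarith)), Real.exp_log (Gamma_pos_of_pos ht0)]
    ring
  have h4 := h1.unique (h2.congr_of_eventuallyEq h3)
  rw [integral_neg, neg_eq_iff_eq_neg] at h4
  rw [h4]
  simp only [Function.comp, Pi.sub_apply]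
  rw [Real.exp_sub, Real.exp_log (Gamma_pos_of_pos (by linarith)), Real.exp_log (Gamma_pos_of_pos hs0)]
  ring

theorem cov_aux {M : ℕ} (A : Matrix (Fin M) (Fin M) ℝ) (hA : A.det ≠ 0) (m : Fin M → ℝ)
    (f : EuclideanSpace ℝ (Fin M) → ℝ) :
    ∫ u : Fin M → ℝ, f (WithLp.toLp 2 (A *ᵥ (u - m))) = |A.det|⁻¹ * ∫ x, f x := by
  rw [integral_sub_right_eq_self (fun u => f (WithLp.toLp 2 (A *ᵥ u))) m]
  have hdet : LinearMap.det (Matrix.toLin' A) ≠ 0 := by rwa [LinearMap.det_toLin']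
  have h1 := Real.map_matrix_volume_pi_eq_smul_volume_pi hA
  have hemb : MeasurableEmbedding (Matrix.toLin' A) :=
    (LinearMap.equivOfDetNeZero (Matrix.toLin' A) hdet).toContinuousLinearEquiv.toHomeomorph.measurableEmbedding
  have h2 := hemb.integral_map (μ := volume) (fun v => f (WithLp.toLp 2 v))
  rw [h1, integral_smul_measure] at h2
  have h3 := (PiLp.volume_preserving_toLp (Fin M)).integral_comp
    (MeasurableEquiv.toLp 2 _).measurableEmbedding f
  simp only [Matrix.toLin'_apply] at h2
  rw [← h2, h3, ENNReal.toReal_ofReal (abs_nonneg _), abs_inv, smul_eq_mul]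

open scoped MatrixOrder in
theorem factor_aux {M : ℕ} (S : Matrix (Fin M) (Fin M) ℝ) (hS : S.PosDef) {c : ℝ} (hc : 0 < c) :
    ∃ A : Matrix (Fin M) (Fin M) ℝ, A.det ≠ 0 ∧
      |A.det|⁻¹ = c ^ ((M:ℝ)/2) * S.det ^ ((1:ℝ)/2) ∧
      ∀ v : Fin M → ℝ, v ⬝ᵥ (S⁻¹ *ᵥ v) / c = ‖WithLp.toLp 2 (A *ᵥ v)‖^2 := by
  obtain ⟨A, hA⟩ : ∃ A : Matrix (Fin M) (Fin M) ℝ, c⁻¹ • S⁻¹ = Aᵀ * A := by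
    have : (c⁻¹ • S⁻¹).PosDef := hS.inv.smul (inv_pos.2 hc)
    obtain ⟨B, hB⟩ := CStarAlgebra.nonneg_iff_eq_star_mul_self.mp this.posSemidef.nonneg
    exact ⟨B, by rw [hB, star_eq_conjTranspose, conjTranspose_eq_transpose_of_trivial]⟩
  have hSd := hS.det_pos
  have hd : A.det ^ 2 = (c ^ M * S.det)⁻¹ := by
    have := congrArg Matrix.det hA
    rw [det_mul, det_transpose, det_smul, Fintype.card_fin, det_nonsing_inv, Ring.inverse_eq_inv'] at this
    rw [sq, ← this, mul_inv, inv_pow]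
  refine ⟨A, ?_, ?_, ?_⟩
  · intro h
    rw [h] at hd
    have : 0 < (c ^ M * S.det)⁻¹ := by positivity
    rw [← hd] at this
    simp at this
  · rw [← sqrt_sq_eq_abs, hd, sqrt_inv, inv_inv, sqrt_eq_rpow, mul_rpow (by positivity) hSd.le,
      ← rpow_natCast, ← rpow_mul hc.le]
    ring_nf
  · intro v
    have h1 : v ⬝ᵥ ((c⁻¹ • S⁻¹) *ᵥ v) = (A *ᵥ v) ⬝ᵥ (A *ᵥ v) := by
      rw [hA, ← mulVec_mulVec, dotProduct_mulVec, vecMul_transpose]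
    rw [smul_mulVec, dotProduct_smul, smul_eq_mul] at h1
    rw [div_eq_inv_mul, h1, EuclideanSpace.real_norm_sq_eq]
    simp [dotProduct, sq]

/-- for `u ~ ST_M(ν̃, m, S)` with `ν̃ > 2`, `S` symmetric positive
definite, `E[log(1 + (u−m)ᵀS⁻¹(u−m)/(ν̃−2))] = Ψ((ν̃+M)/2) − Ψ(ν̃/2)`. -/
theorem studentT_entropy_term {M : ℕ} (ν' : ℝ) (hν' : 2 < ν') (m : Fin M → ℝ)
    (S : Matrix (Fin M) (Fin M) ℝ) (hS : S.PosDef) :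
    (∫ u : Fin M → ℝ,
        Real.log (1 + (u - m) ⬝ᵥ (S⁻¹ *ᵥ (u - m)) / (ν' - 2)) * stPdf ν' m S u) =
      digamma ((ν' + M) / 2) - digamma (ν' / 2) := by
  have hc : 0 < ν' - 2 := by linarith
  have hSd := hS.det_pos
  obtain ⟨A, hA, hdet, hq⟩ := factor_aux S hS hc
  have hs : (M:ℝ)/2 < (ν' + M)/2 := by linarith
  have h1 := cov_aux A hA m (fun x => log (1 + ‖x‖^2) * (1 + ‖x‖^2) ^ (-((ν' + M)/2)))
  rw [bj_log hs, hdet] at h1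
  simp only [← hq] at h1
  have hM : (ν' + M)/2 - M/2 = ν'/2 := by ring
  rw [hM] at h1
  unfold digamma
  set D := deriv (fun t => log (Gamma t)) ((ν' + M) / 2) - deriv (fun t => log (Gamma t)) (ν' / 2)
  set C := (Real.Gamma ((ν' + M) / 2) * S.det ^ (-(1 : ℝ) / 2)) /
      (Real.Gamma (ν' / 2) * ((ν' - 2) * Real.pi) ^ ((M : ℝ) / 2)) with hC
  have h2 : ∀ u : Fin M → ℝ, Real.log (1 + (u - m) ⬝ᵥ (S⁻¹ *ᵥ (u - m)) / (ν' - 2)) * stPdf ν' m S u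
      = C * (Real.log (1 + (u - m) ⬝ᵥ (S⁻¹ *ᵥ (u - m)) / (ν' - 2)) *
        (1 + (u - m) ⬝ᵥ (S⁻¹ *ᵥ (u - m)) / (ν' - 2)) ^ (-((ν' + M) / 2))) := by
    intro u
    rw [stPdf, Fintype.card_fin, ← hC, neg_div]
    ring
  simp_rw [h2]
  rw [integral_const_mul, h1, hC, mul_rpow hc.le pi_pos.le, neg_div, rpow_neg hSd.le]
  have g1 : Gamma (ν'/2) ≠ 0 := (Gamma_pos_of_pos (by linarith)).ne'
  have g2 : Gamma ((ν' + M)/2) ≠ 0 := (Gamma_pos_of_pos (by positivity)).ne'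
  have p1 : (ν' - 2) ^ ((M:ℝ)/2) ≠ 0 := by positivity
  have p2 : π ^ ((M:ℝ)/2) ≠ 0 := by positivity
  have p3 : S.det ^ ((1:ℝ)/2) ≠ 0 := by positivity
  generalize Gamma (ν'/2) = a1 at *
  generalize Gamma ((ν' + M)/2) = a2 at *
  generalize (ν' - 2) ^ ((M:ℝ)/2) = a3 at *
  generalize π ^ ((M:ℝ)/2) = a4 at *
  generalize S.det ^ ((1:ℝ)/2) = a5 at *
  field_simp
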